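/- arXiv:1707.00215 — 3 statements merged into one kernel-verified Lean document; each statement's English description precedes it below -/
import Mathlib

section
/- Let G be a finitely generated residually finite group and let φ : G →* G be a group endomorphism. Then G is separable with respect to the fixed subgroup Fix(φ) = {g ∈ G | φ(g) = g}: for every a ∈ G with φ(a) ≠ a there exists a finite-index subgroup H of G with Fix(φ) ⊆ H and a ∉ H. -/
/-- A group is residually finite if every nontrivial element avoids some
finite-index normal subgroup. -/
def ResiduallyFinite (G : Type*) [Group G] : Prop :=
  ∀ g : G, g ≠ 1 → ∃ N : Subgroup G, N.Normal ∧ N.FiniteIndex ∧ g ∉ N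

/-- The equalizer of two homomorphisms into a finite group has finite index. -/
theorem MonoidHom.finiteIndex_eqLocus {G Q : Type*} [Group G] [Group Q] [Finite Q]
    (f g : G →* Q) : (f.eqLocus g).FiniteIndex := by
  have h : f.ker ⊓ g.ker ≤ f.eqLocus g := fun x hx =>
    (MonoidHom.mem_ker.mp hx.1).trans (MonoidHom.mem_ker.mp hx.2).symm
  exact Subgroup.finiteIndex_of_le h

/-- Wise: a finitely generated residually finite group is separable with respect to
the fixed subgroup of any endomorphism. -/
theorem fg_residuallyFinite_fix_separable {G : Type*} [Group G]
    (hfg : Group.FG G) (hrf : ResiduallyFinite G)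
    (φ : G →* G) (a : G) (ha : φ a ≠ a) :
    ∃ H : Subgroup G, H.FiniteIndex ∧ (∀ g : G, φ g = g → g ∈ H) ∧ a ∉ H := by
  obtain ⟨N, _, _, hN⟩ := hrf (a⁻¹ * φ a) fun h => ha (inv_mul_eq_one.mp h).symm
  refine ⟨(QuotientGroup.mk' N).eqLocus ((QuotientGroup.mk' N).comp φ),
    MonoidHom.finiteIndex_eqLocus _ _, fun g hg => ?_, fun h => hN (QuotientGroup.eq.mp h)⟩
  exact congrArg (QuotientGroup.mk' N) hg.symm
end

section
/- Let A be any Mealy automaton with finite nonempty state set S and finite nonempty alphabet X. Then there exist a nonempty word w over S and a nonempty word u over X such that, denoting by W and U the images in π₁(Δ_A) of the products of the corresponding generators, one has W·U = U·W, and the homomorphism ℤ × ℤ → π₁(Δ_A) sending (1,0) ↦ W and (0,1) ↦ U is injective. In particular π₁(Δ_A) contains a subgroup isomorphic to ℤ². -/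
/-- A Mealy automaton with state set `S` and alphabet `X`:
`λ(s,x) = (o s x, t s x)`. -/
structure Mealy (S X : Type) where
  o : S → X → X
  t : S → X → S

namespace Mealy

variable {S X : Type}

/-- Bireversibility of a Mealy automaton. -/
def Bireversible (M : Mealy S X) : Prop :=
  (∀ s, Function.Bijective (M.o s)) ∧
  (∀ x, Function.Bijective (fun s => M.t s x)) ∧
  Function.Bijective (fun p : S × X => (M.o p.1 p.2, M.t p.1 p.2))

/-- The action of a state on words over the alphabet. -/
def actWord (M : Mealy S X) : S → List X → List X
  | _, [] => []
  | s, x :: w => M.o s x :: M.actWord (M.t s x) w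

/-- The dual action of a letter on words over the states. -/
def dualActWord (M : Mealy S X) : X → List S → List S
  | _, [] => []
  | x, s :: w => M.t s x :: M.dualActWord (M.o s x) w

/-- The relators `s x (t s x)⁻¹ (o s x)⁻¹` of the square-complex group. -/
def rels (M : Mealy S X) : Set (FreeGroup (S ⊕ X)) :=
  ⋃ (s : S) (x : X),
    {FreeGroup.of (Sum.inl s) * FreeGroup.of (Sum.inr x) *
      (FreeGroup.of (Sum.inl (M.t s x)))⁻¹ * (FreeGroup.of (Sum.inr (M.o s x)))⁻¹}

/-- The fundamental group `π₁(Δ_A)` of the square complex of the automaton. -/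
abbrev Pi1 (M : Mealy S X) := PresentedGroup M.rels

/-- The image of a state in `π₁(Δ_A)`. -/
def genS (M : Mealy S X) (s : S) : M.Pi1 := PresentedGroup.of (Sum.inl s)

/-- The image of a letter in `π₁(Δ_A)`. -/
def genX (M : Mealy S X) (x : X) : M.Pi1 := PresentedGroup.of (Sum.inr x)

/-- The subgroup `⟨S⟩` of `π₁(Δ_A)`. -/
def subS (M : Mealy S X) : Subgroup M.Pi1 := Subgroup.closure (Set.range M.genS)

/-- The subgroup `⟨X⟩` of `π₁(Δ_A)`. -/
def subX (M : Mealy S X) : Subgroup M.Pi1 := Subgroup.closure (Set.range M.genX)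

/-- The automaton group `G_A`: the subgroup of `Perm (List X)` generated by the
permutations `σ_s` defined by the states. -/
def autGroup (M : Mealy S X) : Subgroup (Equiv.Perm (List X)) :=
  Subgroup.closure {σ : Equiv.Perm (List X) | ∃ s, ⇑σ = M.actWord s}

/-- The dual automaton group `G_{∂A}`. -/
def dualAutGroup (M : Mealy S X) : Subgroup (Equiv.Perm (List S)) :=
  Subgroup.closure {τ : Equiv.Perm (List S) | ∃ x, ⇑τ = M.dualActWord x}

end Mealy

namespace Mealy

variable {S X : Type}

theorem genS_mul_genX (M : Mealy S X) (s : S) (x : X) :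
    M.genS s * M.genX x = M.genX (M.o s x) * M.genS (M.t s x) := by
  have h : PresentedGroup.mk M.rels
      (FreeGroup.of (Sum.inl s) * FreeGroup.of (Sum.inr x) *
        (FreeGroup.of (Sum.inl (M.t s x)))⁻¹ * (FreeGroup.of (Sum.inr (M.o s x)))⁻¹) = 1 :=
    PresentedGroup.one_of_mem (Set.mem_iUnion₂.2 ⟨s, x, rfl⟩)
  simp only [map_mul, map_inv] at h
  rw [mul_inv_eq_one, mul_inv_eq_iff_eq_mul] at h
  exact h

/-- The homomorphism counting occurrences of states and of letters. -/
def count (M : Mealy S X) : M.Pi1 →* Multiplicative (ℤ × ℤ) :=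
  PresentedGroup.toGroup
    (f := Sum.elim (fun _ => Multiplicative.ofAdd (1, 0)) (fun _ => Multiplicative.ofAdd (0, 1)))
    (by
      intro r hr
      obtain ⟨s, x, rfl⟩ := Set.mem_iUnion₂.1 hr
      simp)

theorem count_genS (M : Mealy S X) (s : S) :
    M.count (M.genS s) = Multiplicative.ofAdd (1, 0) :=
  PresentedGroup.toGroup.of _

theorem count_genX (M : Mealy S X) (x : X) :
    M.count (M.genX x) = Multiplicative.ofAdd (0, 1) :=
  PresentedGroup.toGroup.of _

theorem count_prod_genS (M : Mealy S X) (w : List S) :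
    M.count (w.map M.genS).prod = Multiplicative.ofAdd ((w.length : ℤ), 0) := by
  induction w with
  | nil => rw [List.map_nil, List.prod_nil, map_one]; rfl
  | cons s w ih =>
    rw [List.map_cons, List.prod_cons, map_mul, ih, count_genS, ← ofAdd_add]
    simp [add_comm]

theorem count_prod_genX (M : Mealy S X) (u : List X) :
    M.count (u.map M.genX).prod = Multiplicative.ofAdd (0, (u.length : ℤ)) := by
  induction u with
  | nil => rw [List.map_nil, List.prod_nil, map_one]; rfl
  | cons x u ih =>
    rw [List.map_cons, List.prod_cons, map_mul, ih, count_genX, ← ofAdd_add]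
    simp [add_comm]

theorem injective_zpow_mul_zpow (M : Mealy S X) {w : List S} {u : List X}
    (hw : w ≠ []) (hu : u ≠ []) :
    Function.Injective (fun p : ℤ × ℤ =>
      (w.map M.genS).prod ^ p.1 * (u.map M.genX).prod ^ p.2) := by
  rintro ⟨a, b⟩ ⟨c, d⟩ h
  have h' := congrArg M.count h
  simp only [map_mul, map_zpow, count_prod_genS, count_prod_genX, ← ofAdd_zsmul,
    ← ofAdd_add, EmbeddingLike.apply_eq_iff_eq, Prod.smul_mk, Prod.mk_add_mk, smul_eq_mul,
    mul_zero, add_zero, zero_add, Prod.mk.injEq] at h'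
  have hw' : (w.length : ℤ) ≠ 0 := by simpa using hw
  have hu' : (u.length : ℤ) ≠ 0 := by simpa using hu
  exact Prod.ext (mul_right_cancel₀ hw' h'.1) (mul_right_cancel₀ hu' h'.2)

end Mealy

section Staircase

variable {G : Type*} [Monoid G] {a b : ℕ → G}

theorem reverse_range_prod_mul (h : ∀ k, a k * b k = b (k + 1) * a (k + 1)) (n k : ℕ) :
    ((List.range n).map fun i => a (k + i)).reverse.prod * b k =
      b (k + n) * ((List.range n).map fun i => a (k + 1 + i)).reverse.prod := by
  induction n with
  | zero => simp
  | succ n ih =>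
    simp only [List.range_succ, List.map_append, List.map_singleton, List.reverse_append,
      List.reverse_singleton, List.prod_append, List.prod_singleton]
    rw [mul_assoc, ih, ← mul_assoc, h, mul_assoc, add_right_comm k 1 n, add_assoc k n 1]

theorem reverse_range_prod_mul_range_prod (h : ∀ k, a k * b k = b (k + 1) * a (k + 1)) {n : ℕ}
    (hb : Function.Periodic b n) (m : ℕ) :
    ((List.range n).map a).reverse.prod * ((List.range m).map b).prod =
      ((List.range m).map b).prod * ((List.range n).map fun i => a (m + i)).reverse.prod := by
  induction m with
  | zero => simp
  | succ m ih =>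
    simp only [List.range_succ, List.map_append, List.map_singleton, List.prod_append,
      List.prod_singleton]
    rw [← mul_assoc, ih, mul_assoc, reverse_range_prod_mul h, hb m, mul_assoc]

theorem commute_reverse_range_prod_range_prod (h : ∀ k, a k * b k = b (k + 1) * a (k + 1))
    {n : ℕ} (ha : Function.Periodic a n) (hb : Function.Periodic b n) :
    Commute ((List.range n).map a).reverse.prod ((List.range n).map b).prod := by
  have := reverse_range_prod_mul_range_prod h hb n
  simp only [add_comm n, ha _] at this
  exact this

end Staircase

theorem Function.exists_isPeriodicPt_of_finite {α : Type*} [Finite α] [Nonempty α] (f : α → α) :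
    ∃ x n, 0 < n ∧ Function.IsPeriodicPt f n x := by
  obtain ⟨x⟩ := ‹Nonempty α›
  obtain ⟨i, j, hij, h⟩ := Finite.exists_ne_map_eq_of_infinite fun n : ℕ => f^[n] x
  wlog hlt : i < j generalizing i j
  · exact this j i hij.symm h.symm (by omega)
  refine ⟨f^[i] x, j - i, by omega, ?_⟩
  rw [Function.IsPeriodicPt, Function.IsFixedPt, ← Function.iterate_add_apply,
    Nat.sub_add_cancel hlt.le]
  exact h.symm

open Mealy in
/-- For any finite Mealy automaton, the tileset admits a periodic tiling and
`π₁(Δ_A)` contains `ℤ²`: there are nonempty words `w` over `S` and `u` over `X`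
whose images `W`, `U` commute and generate a copy of `ℤ × ℤ`. -/
theorem pi1_contains_Z2 {S X : Type} [Finite S] [Finite X] [Nonempty S] [Nonempty X]
    (M : Mealy S X) :
    ∃ (w : List S) (u : List X), w ≠ [] ∧ u ≠ [] ∧
      (w.map M.genS).prod * (u.map M.genX).prod =
        (u.map M.genX).prod * (w.map M.genS).prod ∧
      Function.Injective (fun p : ℤ × ℤ =>
        (w.map M.genS).prod ^ p.1 * (u.map M.genX).prod ^ p.2) := by
  obtain ⟨c, n, hn, hc⟩ :=
    Function.exists_isPeriodicPt_of_finite fun p : S × X => (M.t p.1 p.2, M.o p.1 p.2)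
  set f : S × X → S × X := fun p => (M.t p.1 p.2, M.o p.1 p.2)
  have hper : Function.Periodic (fun k => f^[k] c) n := fun k => by
    simp only [Function.iterate_add_apply, hc.eq]
  have hstep (k : ℕ) : M.genS (f^[k] c).1 * M.genX (f^[k] c).2 =
      M.genX (f^[k + 1] c).2 * M.genS (f^[k + 1] c).1 := by
    rw [Function.iterate_succ_apply', genS_mul_genX]
  have hw : ((List.range n).map fun k => (f^[k] c).1).reverse ≠ [] := by simp [hn.ne']
  have hu : ((List.range n).map fun k => (f^[k] c).2) ≠ [] := by simp [hn.ne']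
  refine ⟨_, _, hw, hu, ?_, M.injective_zpow_mul_zpow hw hu⟩
  rw [List.map_reverse, List.map_map, List.map_map]
  exact commute_reverse_range_prod_range_prod hstep
    (hper.comp fun p => M.genS p.1) (hper.comp fun p => M.genX p.2)
end

section
/- Let A be a bireversible automaton. The following are equivalent: (1) the automaton group G_A is finite; (2) the dual automaton group G_{∂A} is finite; (3) π₁(Δ_A) is reducible, i.e. there exist subgroups K ≤ ⟨S⟩ and H ≤ ⟨X⟩ of π₁(Δ_A) such that every element of K commutes with every element of H, K ∩ H = {1}, and the subgroup generated by K ∪ H has finite index in π₁(Δ_A). -/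
open Mealy

/-- `π₁(Δ_A)` is reducible: it contains a finite-index subgroup of the form `K × H`
with `K ≤ ⟨S⟩` and `H ≤ ⟨X⟩`. -/
def Mealy.Reducible {S X : Type} (M : Mealy S X) : Prop :=
  ∃ K H : Subgroup M.Pi1, K ≤ M.subS ∧ H ≤ M.subX ∧
    (∀ k ∈ K, ∀ h ∈ H, Commute k h) ∧ K ⊓ H = ⊥ ∧ (K ⊔ H).FiniteIndex

open scoped Pointwise

namespace Subgroup

variable {P : Type*} [Group P]

theorem mem_toConjAct_smul_iff {A : Subgroup P} {g x : P} :
    x ∈ ConjAct.toConjAct g • A ↔ g⁻¹ * x * g ∈ A := by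
  rw [mem_pointwise_smul_iff_inv_smul_mem, ← map_inv, ConjAct.toConjAct_smul, inv_inv]

/-- A subgroup whose left cosets in `L` are separated by a map to a finite type has finite
index in `L`. -/
theorem relIndex_ne_zero_of_finite_separation {ι : Type*} [Finite ι] {J L : Subgroup P} (f : L → ι)
    (hf : ∀ a b : L, f a = f b → (a : P)⁻¹ * b ∈ J) : J.relIndex L ≠ 0 := by
  have : Finite (L ⧸ J.subgroupOf L) := by
    refine Finite.of_injective (fun q => f q.out) fun p q h => ?_
    rw [← QuotientGroup.out_eq' p, ← QuotientGroup.out_eq' q, QuotientGroup.eq, mem_subgroupOf]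
    exact hf _ _ h
  exact Nat.card_pos.ne'

/-- If `A` and `B` meet trivially, `B * A` is everything and `A` is commensurated, then a
finite-index product `K × H` with `K ≤ A` and `H ≤ B` forces the core of `A` to have finite
index in `A`. -/
theorem normalCore_relIndex_ne_zero {A B K H : Subgroup P} (hAB : A ⊓ B = ⊥)
    (hBA : ∀ p : P, ∃ b ∈ B, ∃ a ∈ A, p = b * a)
    (hA : Commensurable.commensurator A = ⊤) (hK : K ≤ A) (hH : H ≤ B)
    (hcomm : ∀ k ∈ K, ∀ h ∈ H, Commute k h) (hfin : (K ⊔ H).FiniteIndex) :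
    A.normalCore.relIndex A ≠ 0 := by
  have hmem : ∀ p ∈ K ⊔ H, ∃ k ∈ K, ∃ h ∈ H, p = k * h := by
    intro p hp
    let φ := MonoidHom.noncommCoprod K.subtype H.subtype fun k h => hcomm k k.2 h h.2
    have : p ∈ φ.range := by
      have hφ : φ.range = K ⊔ H := (MonoidHom.noncommCoprod_range _ _ _).trans (by simp)
      rwa [hφ]
    obtain ⟨⟨k, h⟩, rfl⟩ := this
    exact ⟨k, k.2, h, h.2, rfl⟩
  have htriv : ∀ p, p ∈ A → p ∈ B → p = 1 := fun p h₁ h₂ => by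
    have : p ∈ A ⊓ B := ⟨h₁, h₂⟩
    rwa [hAB, mem_bot] at this
  have hrel : ∀ L : Subgroup P, (K ⊔ H).relIndex L ≠ 0 := fun L =>
    (inferInstance : ((K ⊔ H).subgroupOf L).FiniteIndex).index_ne_zero
  have hKA : K.relIndex A ≠ 0 := by
    have h := hrel A
    rw [← inf_relIndex_right] at h
    refine fun h0 => h (relIndex_eq_zero_of_le_left ?_ h0)
    rintro p ⟨hp, hpA⟩
    obtain ⟨k, hk, h, hh, rfl⟩ := hmem p hp
    have := htriv h ((mul_mem_cancel_left (hK hk)).1 hpA) (hH hh)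
    simpa [this] using hk
  have hHB : H.relIndex B ≠ 0 := by
    have h := hrel B
    rw [← inf_relIndex_right] at h
    refine fun h0 => h (relIndex_eq_zero_of_le_left ?_ h0)
    rintro p ⟨hp, hpB⟩
    obtain ⟨k, hk, h, hh, rfl⟩ := hmem p hp
    have := htriv k (hK hk) ((mul_mem_cancel_right (hH hh)).1 hpB)
    simpa [this] using hh
  have : Finite (B ⧸ H.subgroupOf B) := Nat.finite_of_card_ne_zero hHB
  let L : Subgroup P :=
    K ⊓ ⨅ q : B ⧸ H.subgroupOf B, ConjAct.toConjAct ((q.out : P)⁻¹) • A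
  have hL : L.relIndex A ≠ 0 := by
    refine relIndex_inf_ne_zero hKA (relIndex_iInf_ne_zero fun q => ?_)
    have : ((q.out : P)⁻¹) ∈ Commensurable.commensurator A := hA ▸ mem_top _
    exact this.1
  refine fun h0 => hL (relIndex_eq_zero_of_le_left ?_ h0)
  rintro l ⟨hlK, hl⟩ p
  replace hl : ∀ q : B ⧸ H.subgroupOf B, (q.out : P) * l * (q.out : P)⁻¹ ∈ A := fun q => by
    simpa using mem_toConjAct_smul_iff.1 (mem_iInf.1 hl q)
  obtain ⟨b, hb, a, ha, hp⟩ := hBA p⁻¹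
  let q : B ⧸ H.subgroupOf B := QuotientGroup.mk ⟨b⁻¹, inv_mem hb⟩
  have hq : (⟨b⁻¹, inv_mem hb⟩ : B)⁻¹ * q.out ∈ H.subgroupOf B := by
    rw [← QuotientGroup.eq]; exact (QuotientGroup.out_eq' q).symm
  have hh : b * (q.out : P) ∈ H := by simpa [mem_subgroupOf] using hq
  have hc : l * (b * (q.out : P)) = b * q.out * l := hcomm l hlK _ hh
  have key : p * l * p⁻¹ = a⁻¹ * (q.out * l * (q.out : P)⁻¹) * a := by
    have hp' : p = a⁻¹ * b⁻¹ := by rw [← inv_inv p, hp, mul_inv_rev]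
    have e : b⁻¹ * l * b = q.out * l * (q.out : P)⁻¹ := by
      have : l * b = b * q.out * l * (q.out : P)⁻¹ := by rw [← hc]; group
      rw [mul_assoc, this]; group
    rw [hp, hp', ← e]; group
  rw [key]
  exact mul_mem (mul_mem (inv_mem ha) (hl q)) ha

/-- If `A` and `B` meet trivially, `A * B` is everything, `A` is finitely generated and `B` is
commensurated, then `P` is virtually a product as soon as the core of `A` has finite index
in `A`. -/
theorem exists_commuting_of_normalCore_relIndex_ne_zero {A B : Subgroup P} (hAB : A ⊓ B = ⊥)
    (hBA : ∀ p : P, ∃ a ∈ A, ∃ b ∈ B, p = a * b) (hfg : Group.FG A)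
    (hB : Commensurable.commensurator B = ⊤) (hA : A.normalCore.relIndex A ≠ 0) :
    ∃ K H : Subgroup P, K ≤ A ∧ H ≤ B ∧
      (∀ k ∈ K, ∀ h ∈ H, Commute k h) ∧ K ⊓ H = ⊥ ∧ (K ⊔ H).FiniteIndex := by
  have htriv : ∀ p, p ∈ A → p ∈ B → p = 1 := fun p h₁ h₂ => by
    have : p ∈ A ⊓ B := ⟨h₁, h₂⟩
    rwa [hAB, mem_bot] at this
  have hCA : A.normalCore ≤ A := A.normalCore_le
  have : A.normalCore.IsFiniteRelIndex A := ⟨hA⟩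
  have : (A.normalCore.subgroupOf A).FiniteIndex := ⟨hA⟩
  have hCfg : Group.FG A.normalCore :=
    Group.fg_of_surjective (f := (subgroupOfEquivOfLe hCA).toMonoidHom)
      (subgroupOfEquivOfLe hCA).surjective
  obtain ⟨T, hT⟩ := (Group.fg_iff_subgroup_fg _).1 hCfg
  let H : Subgroup P := B ⊓ ⨅ t : T, centralizer {(t : P)}
  have hHB : H ≤ B := inf_le_left
  have hHrel : H.relIndex B ≠ 0 := by
    refine relIndex_inf_ne_zero (by simp) (relIndex_iInf_ne_zero fun t => ?_)
    have htC : (t : P) ∈ A.normalCore := hT ▸ subset_closure t.2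
    have : (t : P) ∈ Commensurable.commensurator B := hB ▸ mem_top _
    have h := this.1
    rw [← inf_relIndex_right] at h
    refine fun h0 => h (relIndex_eq_zero_of_le_left ?_ h0)
    rintro b ⟨hb, hbB⟩
    replace hb := mem_toConjAct_smul_iff.1 hb
    rw [mem_centralizer_singleton_iff]
    have h1 : (t : P)⁻¹ * b * t * b⁻¹ ∈ A := by
      have := mul_mem (inv_mem htC) (A.normalCore_normal.conj_mem _ htC b)
      simpa [mul_assoc] using hCA this
    have := htriv _ h1 (mul_mem hb (inv_mem hbB))
    have h2 : (t : P)⁻¹ * b * t = b := mul_inv_eq_one.1 this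
    rw [mul_assoc, inv_mul_eq_iff_eq_mul] at h2
    exact h2
  have hcomm : ∀ k ∈ A.normalCore, ∀ h ∈ H, Commute k h := by
    intro k hk h hh
    have : A.normalCore ≤ centralizer {h} := by
      rw [← hT, closure_le]
      intro t ht
      have := (mem_iInf.1 hh.2) ⟨t, ht⟩
      rw [mem_centralizer_singleton_iff] at this
      rw [SetLike.mem_coe, mem_centralizer_singleton_iff]
      exact this.symm
    exact mem_centralizer_singleton_iff.1 (this hk)
  refine ⟨A.normalCore, H, hCA, hHB, hcomm, ?_, ?_⟩
  · exact le_bot_iff.1 (hAB ▸ inf_le_inf hCA hHB)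
  · have : Finite (A ⧸ A.normalCore.subgroupOf A) := Nat.finite_of_card_ne_zero hA
    have : Finite (B ⧸ H.subgroupOf B) := Nat.finite_of_card_ne_zero hHrel
    let f : (A ⧸ A.normalCore.subgroupOf A) × (B ⧸ H.subgroupOf B) →
        P ⧸ (A.normalCore ⊔ H) := fun q => QuotientGroup.mk ((q.1.out : P) * q.2.out)
    have hf : Function.Surjective f := by
      intro p
      obtain ⟨p, rfl⟩ := QuotientGroup.mk_surjective p
      obtain ⟨a, ha, b, hb, rfl⟩ := hBA p
      refine ⟨(QuotientGroup.mk ⟨a, ha⟩, QuotientGroup.mk ⟨b, hb⟩), ?_⟩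
      obtain ⟨c, hc⟩ := QuotientGroup.mk_out_eq_mul (A.normalCore.subgroupOf A) ⟨a, ha⟩
      obtain ⟨h, hh⟩ := QuotientGroup.mk_out_eq_mul (H.subgroupOf B) ⟨b, hb⟩
      simp only [f]
      rw [hc, hh, QuotientGroup.eq]
      have hcC : ((c : A) : P) ∈ A.normalCore := mem_subgroupOf.1 c.2
      have hhH : ((h : B) : P) ∈ H := mem_subgroupOf.1 h.2
      simp only [coe_mul]
      have : (a * c * (b * h) : P)⁻¹ * (a * b) =
          (h : P)⁻¹ * (b⁻¹ * (c : P)⁻¹ * b⁻¹⁻¹) := by group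
      rw [this]
      exact mul_mem (inv_mem (mem_sup_right hhH))
        (mem_sup_left (A.normalCore_normal.conj_mem _ (inv_mem hcC) _))
    have := Finite.of_surjective f hf
    exact finiteIndex_of_finite_quotient

end Subgroup

namespace Mealy

variable {S X : Type} {P : Type*} [Group P]

/-- The dual automaton, with states and letters exchanged. -/
def dual (M : Mealy S X) : Mealy X S where
  o x s := M.t s x
  t x s := M.o s x

theorem Bireversible.dual {M : Mealy S X} (hb : M.Bireversible) : M.dual.Bireversible :=
  ⟨hb.2.1, hb.1,
    Prod.swap_bijective.comp (hb.2.2.comp Prod.swap_bijective)⟩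

theorem actWord_dual (M : Mealy S X) (x : X) : M.dual.actWord x = M.dualActWord x := by
  funext w
  induction w generalizing x with
  | nil => rfl
  | cons s w ih => exact congrArg _ (ih _)

theorem autGroup_dual (M : Mealy S X) : M.dual.autGroup = M.dualAutGroup := by
  simp only [autGroup, dualAutGroup, actWord_dual]

/-- Families of group elements indexed by the states and letters of `M` that satisfy the relations
of the square complex. -/
def IsRep (M : Mealy S X) (g : S → P) (h : X → P) : Prop :=
  ∀ s x, g s * h x = h (M.o s x) * g (M.t s x)

theorem IsRep.dual {M : Mealy S X} {g : S → P} {h : X → P} (hr : M.IsRep g h) :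
    M.dual.IsRep h⁻¹ g⁻¹ := fun x s => by
  have := congrArg (·⁻¹) (hr s x)
  simpa [Mealy.dual] using this

theorem IsRep.exists_mul_letter {M : Mealy S X} {g : S → P} {h : X → P} (hr : M.IsRep g h)
    (hb : M.Bireversible) {a : P} (ha : a ∈ Subgroup.closure (Set.range g)) (x : X) :
    ∃ b ∈ Subgroup.closure (Set.range g), ∃ y, a * h x = h y * b := by
  induction ha using Subgroup.closure_induction'' generalizing x with
  | mem _ hs =>
    obtain ⟨s, rfl⟩ := hs
    exact ⟨_, Subgroup.subset_closure ⟨_, rfl⟩, _, hr s x⟩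
  | inv_mem _ hs =>
    obtain ⟨s, rfl⟩ := hs
    obtain ⟨x', rfl⟩ := (hb.1 s).2 x
    refine ⟨_, inv_mem (Subgroup.subset_closure ⟨M.t s x', rfl⟩), x', ?_⟩
    rw [inv_mul_eq_iff_eq_mul, ← mul_assoc, hr, mul_inv_cancel_right]
  | one => exact ⟨1, one_mem _, x, by simp⟩
  | mul a a' _ _ ih ih' =>
    obtain ⟨b', hb', y', e'⟩ := ih' x
    obtain ⟨b, hb, y, e⟩ := ih y'
    exact ⟨b * b', mul_mem hb hb', y, by rw [mul_assoc, e', ← mul_assoc, e, mul_assoc]⟩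

theorem IsRep.exists_letter_mul {M : Mealy S X} {g : S → P} {h : X → P} (hr : M.IsRep g h)
    (hb : M.Bireversible) {b : P} (hbg : b ∈ Subgroup.closure (Set.range g)) (x : X) :
    ∃ a ∈ Subgroup.closure (Set.range g), ∃ y, a * h x = h y * b := by
  induction hbg using Subgroup.closure_induction'' generalizing x with
  | mem _ hs =>
    obtain ⟨s, rfl⟩ := hs
    obtain ⟨s', rfl⟩ := (hb.2.1 x).2 s
    exact ⟨_, Subgroup.subset_closure ⟨_, rfl⟩, _, hr s' x⟩
  | inv_mem _ hs =>
    obtain ⟨s, rfl⟩ := hs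
    obtain ⟨⟨s', x'⟩, e⟩ := hb.2.2.2 (x, s)
    obtain ⟨rfl, rfl⟩ := Prod.ext_iff.1 e
    refine ⟨_, inv_mem (Subgroup.subset_closure ⟨s', rfl⟩), x', ?_⟩
    dsimp only
    rw [inv_mul_eq_iff_eq_mul, ← mul_assoc, hr, mul_inv_cancel_right]
  | one => exact ⟨1, one_mem _, x, by simp⟩
  | mul b b' _ _ ih ih' =>
    obtain ⟨a', ha', y', e'⟩ := ih' x
    obtain ⟨a, ha, y, e⟩ := ih y'
    exact ⟨a * a', mul_mem ha ha', y, by rw [mul_assoc, e', ← mul_assoc, e, mul_assoc]⟩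

theorem IsRep.commensurator_eq_top [Finite X] {M : Mealy S X} {g : S → P} {h : X → P}
    (hr : M.IsRep g h) (hb : M.Bireversible)
    (htop : Subgroup.closure (Set.range g) ⊔ Subgroup.closure (Set.range h) = ⊤) :
    Subgroup.Commensurable.commensurator (Subgroup.closure (Set.range g)) = ⊤ := by
  rw [eq_top_iff, ← htop]
  refine sup_le ?_ ((Subgroup.closure_le _).2 ?_)
  · intro a ha
    rw [Subgroup.Commensurable.commensurator_mem_iff]
    have : ConjAct.toConjAct a • Subgroup.closure (Set.range g) = Subgroup.closure (Set.range g) := by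
      ext p
      rw [Subgroup.mem_toConjAct_smul_iff, Subgroup.mul_mem_cancel_right _ ha,
        Subgroup.mul_mem_cancel_left _ (inv_mem ha)]
    rw [this]
  · rintro _ ⟨x, rfl⟩
    rw [SetLike.mem_coe, Subgroup.Commensurable.commensurator_mem_iff,
      Subgroup.Commensurable]
    constructor
    · choose b hbg y hy using fun a : Subgroup.closure (Set.range g) =>
        hr.exists_mul_letter hb a.2 x
      refine Subgroup.relIndex_ne_zero_of_finite_separation y fun a a' e => ?_
      rw [Subgroup.mem_toConjAct_smul_iff]
      have : (h x)⁻¹ * ((a : P)⁻¹ * a') * h x = (b a)⁻¹ * b a' := by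
        rw [show (h x)⁻¹ * ((a : P)⁻¹ * a') * h x = (a * h x)⁻¹ * (a' * h x) by group,
          hy, hy, e]
        group
      rw [this]
      exact mul_mem (inv_mem (hbg _)) (hbg _)
    · have key : (ConjAct.toConjAct (h x)⁻¹ • Subgroup.closure (Set.range g)).relIndex
          (Subgroup.closure (Set.range g)) ≠ 0 := by
        choose a hag y hy using fun b : Subgroup.closure (Set.range g) =>
          hr.exists_letter_mul hb b.2 x
        refine Subgroup.relIndex_ne_zero_of_finite_separation y fun b b' e => ?_
        rw [Subgroup.mem_toConjAct_smul_iff, inv_inv]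
        have hb_eq : ∀ b : Subgroup.closure (Set.range g),
            (b : P) = (h (y b))⁻¹ * (a b * h x) := fun b => by rw [hy]; group
        have : h x * ((b : P)⁻¹ * b') * (h x)⁻¹ = (a b)⁻¹ * a b' := by
          rw [hb_eq b, hb_eq b', e]
          group
        rw [this]
        exact mul_mem (inv_mem (hag _)) (hag _)
      rwa [← Subgroup.relIndex_pointwise_smul (ConjAct.toConjAct (h x)), ConjAct.toConjAct_inv,
        smul_inv_smul] at key

theorem IsRep.exists_eq_mul {M : Mealy S X} {g : S → P} {h : X → P}
    (hr : M.IsRep g h) (hb : M.Bireversible)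
    (htop : Subgroup.closure (Set.range g) ⊔ Subgroup.closure (Set.range h) = ⊤) (p : P) :
    ∃ b ∈ Subgroup.closure (Set.range h), ∃ a ∈ Subgroup.closure (Set.range g), p = b * a := by
  have swap : ∀ b ∈ Subgroup.closure (Set.range h), ∀ a ∈ Subgroup.closure (Set.range g),
      ∃ b' ∈ Subgroup.closure (Set.range h), ∃ a' ∈ Subgroup.closure (Set.range g),
        a * b = b' * a' := by
    intro b hbh
    induction hbh using Subgroup.closure_induction'' with
    | mem _ hx =>
      obtain ⟨x, rfl⟩ := hx
      intro a ha
      obtain ⟨a', ha', y, e⟩ := hr.exists_mul_letter hb ha x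
      exact ⟨_, Subgroup.subset_closure ⟨y, rfl⟩, a', ha', e⟩
    | inv_mem _ hx =>
      obtain ⟨x, rfl⟩ := hx
      intro a ha
      obtain ⟨a', ha', y, e⟩ := hr.exists_letter_mul hb ha x
      refine ⟨_, inv_mem (Subgroup.subset_closure ⟨y, rfl⟩), a', ha', ?_⟩
      rw [mul_inv_eq_iff_eq_mul, mul_assoc, e, inv_mul_cancel_left]
    | one => exact fun a ha => ⟨1, one_mem _, a, ha, by simp⟩
    | mul b₁ b₂ _ _ ih₁ ih₂ =>
      intro a ha
      obtain ⟨b₁', hb₁, a₁, ha₁, e₁⟩ := ih₁ a ha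
      obtain ⟨b₂', hb₂, a₂, ha₂, e₂⟩ := ih₂ a₁ ha₁
      exact ⟨b₁' * b₂', mul_mem hb₁ hb₂, a₂, ha₂, by
        rw [← mul_assoc, e₁, mul_assoc, e₂, mul_assoc]⟩
  have hp : p ∈ Subgroup.closure (Set.range g ∪ Set.range h) := by
    rw [Subgroup.closure_union, htop]; trivial
  induction hp using Subgroup.closure_induction with
  | mem p hp =>
    obtain hp | hp := hp
    · exact ⟨1, one_mem _, p, Subgroup.subset_closure hp, by simp⟩
    · exact ⟨p, Subgroup.subset_closure hp, 1, one_mem _, by simp⟩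
  | one => exact ⟨1, one_mem _, 1, one_mem _, by simp⟩
  | mul _ _ _ _ ih₁ ih₂ =>
    obtain ⟨b₁, hb₁, a₁, ha₁, rfl⟩ := ih₁
    obtain ⟨b₂, hb₂, a₂, ha₂, rfl⟩ := ih₂
    obtain ⟨b, hb, a, ha, e⟩ := swap b₂ hb₂ a₁ ha₁
    exact ⟨b₁ * b, mul_mem hb₁ hb, a * a₂, mul_mem ha ha₂, by
      rw [mul_assoc, ← mul_assoc a₁, e]; group⟩
  | inv _ _ ih =>
    obtain ⟨b, hb, a, ha, rfl⟩ := ih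
    rw [mul_inv_rev]
    exact swap _ (inv_mem hb) _ (inv_mem ha)

end Mealy

namespace Mealy

variable {S X : Type}

/-- `N` is the automaton whose states are the inverses of the states of `M`. -/
def IsInverse (M N : Mealy S X) : Prop :=
  ∀ s x, N.o s (M.o s x) = x ∧ N.t s (M.o s x) = M.t s x

theorem IsInverse.symm {M N : Mealy S X} (h : M.IsInverse N)
    (ho : ∀ s, Function.Surjective (M.o s)) : N.IsInverse M := fun s y => by
  obtain ⟨x, rfl⟩ := ho s y
  simp [h s x]

theorem IsInverse.actWord_leftInverse {M N : Mealy S X} (h : M.IsInverse N) (s : S) :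
    Function.LeftInverse (N.actWord s) (M.actWord s) := fun w => by
  induction w generalizing s with
  | nil => rfl
  | cons x w ih => simp [actWord, h s x, ih]

/-- The automaton of inverse states. -/
noncomputable def inverse (M : Mealy S X) (hb : M.Bireversible) : Mealy S X where
  o s := (Equiv.ofBijective _ (hb.1 s)).symm
  t s y := M.t s ((Equiv.ofBijective _ (hb.1 s)).symm y)

theorem isInverse_inverse (M : Mealy S X) (hb : M.Bireversible) :
    M.IsInverse (M.inverse hb) := fun s x => by
  have : (Equiv.ofBijective _ (hb.1 s)).symm (M.o s x) = x :=
    (Equiv.ofBijective _ (hb.1 s)).symm_apply_apply x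
  simp [inverse, this]

theorem inverse_t_bijective [Finite S] (M : Mealy S X) (hb : M.Bireversible) (y : X) :
    Function.Bijective fun s => (M.inverse hb).t s y := by
  refine Finite.injective_iff_bijective.1 fun s s' h => ?_
  obtain ⟨x, hx⟩ := (hb.1 s).2 y
  obtain ⟨x', hx'⟩ := (hb.1 s').2 y
  have h₁ := (M.isInverse_inverse hb s x).2
  have h₂ := (M.isInverse_inverse hb s' x').2
  rw [hx] at h₁
  rw [hx'] at h₂
  have : (s, x) = (s', x') := hb.2.2.1 (Prod.ext (hx.trans hx'.symm) (h₁.symm.trans (h.trans h₂)))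
  exact congrArg Prod.fst this

/-- One step of the automaton, recording the output letter in a free group. -/
noncomputable def stepPerm (M : Mealy S X) (ht : ∀ x, Function.Bijective fun s => M.t s x) (x : X) :
    Equiv.Perm (FreeGroup X × S) :=
  Equiv.ofBijective (fun p => (p.1 * FreeGroup.of (M.o p.2 x), M.t p.2 x)) <| by
    constructor
    · rintro ⟨u, s⟩ ⟨v, s'⟩ h
      obtain ⟨h₁, h₂⟩ := Prod.ext_iff.1 h
      obtain rfl : s = s' := (ht x).1 h₂
      exact Prod.ext (mul_right_cancel h₁) rfl
    · rintro ⟨u, s⟩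
      obtain ⟨s', rfl⟩ := (ht x).2 s
      exact ⟨(u * (FreeGroup.of (M.o s' x))⁻¹, s'), by simp⟩

theorem stepPerm_apply (M : Mealy S X) (ht : ∀ x, Function.Bijective fun s => M.t s x) (x : X)
    (p : FreeGroup X × S) :
    M.stepPerm ht x p = (p.1 * FreeGroup.of (M.o p.2 x), M.t p.2 x) := rfl

/-- Running the automaton on elements of the free group, read from left to right. -/
noncomputable def run (M : Mealy S X) (ht : ∀ x, Function.Bijective fun s => M.t s x) :
    FreeGroup X →* (Equiv.Perm (FreeGroup X × S))ᵐᵒᵖ :=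
  FreeGroup.lift fun x => MulOpposite.op (M.stepPerm ht x)

section run

variable (M : Mealy S X) (ht : ∀ x, Function.Bijective fun s => M.t s x)

theorem run_mul_apply (v w : FreeGroup X) (p : FreeGroup X × S) :
    (M.run ht (v * w)).unop p = (M.run ht w).unop ((M.run ht v).unop p) := by
  rw [map_mul, MulOpposite.unop_mul, Equiv.Perm.mul_apply]

theorem run_of_apply (x : X) (p : FreeGroup X × S) :
    (M.run ht (FreeGroup.of x)).unop p = (p.1 * FreeGroup.of (M.o p.2 x), M.t p.2 x) := by
  rw [run, FreeGroup.lift_apply_of, MulOpposite.unop_op, stepPerm_apply]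

theorem run_inv_of_apply (x : X) (u : FreeGroup X) (s : S) :
    (M.run ht (FreeGroup.of x)⁻¹).unop (u, M.t s x) = (u * (FreeGroup.of (M.o s x))⁻¹, s) := by
  rw [map_inv, MulOpposite.unop_inv, Equiv.Perm.inv_eq_iff_eq, run_of_apply,
    inv_mul_cancel_right]

theorem run_apply_mul (w u v : FreeGroup X) (s : S) :
    (M.run ht w).unop (u * v, s) =
      (u * ((M.run ht w).unop (v, s)).1, ((M.run ht w).unop (v, s)).2) := by
  induction w using FreeGroup.induction_on generalizing v s with
  | C1 => simp
  | of x => simp [run_of_apply, mul_assoc]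
  | inv_of x _ =>
    obtain ⟨s', rfl⟩ := (ht x).2 s
    simp only [run_inv_of_apply, mul_assoc]
  | mul w₁ w₂ ih₁ ih₂ => simp only [run_mul_apply, ih₁, ih₂]

theorem run_apply (w u : FreeGroup X) (s : S) :
    (M.run ht w).unop (u, s) =
      (u * ((M.run ht w).unop (1, s)).1, ((M.run ht w).unop (1, s)).2) := by
  simpa using M.run_apply_mul ht w u 1 s

variable {M} in
theorem IsInverse.run_run {N : Mealy S X} (h : M.IsInverse N)
    (hN : ∀ x, Function.Bijective fun s => N.t s x) (w : FreeGroup X) (s : S) :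
    (N.run hN ((M.run ht w).unop (1, s)).1).unop (1, s) =
      (w, ((M.run ht w).unop (1, s)).2) := by
  induction w using FreeGroup.induction_on generalizing s with
  | C1 => simp
  | of x => simp [run_of_apply, h s x]
  | inv_of x _ =>
    obtain ⟨s', rfl⟩ := (ht x).2 s
    simp only [run_inv_of_apply, one_mul]
    have := N.run_inv_of_apply hN (M.o s' x) 1 s'
    rw [(h s' x).2, (h s' x).1] at this
    simpa using this
  | mul w₁ w₂ ih₁ ih₂ =>
    have e₁ := ih₁ s
    rw [run_mul_apply]
    generalize (M.run ht w₁).unop (1, s) = p at e₁ ⊢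
    obtain ⟨v, t⟩ := p
    dsimp only at e₁
    rw [M.run_apply ht w₂ v t, run_mul_apply, e₁, run_apply, ih₂]

end run

/-- The element of `π₁(Δ_A)` spelled by a word over the alphabet. -/
def wordElt (M : Mealy S X) (w : List X) : M.Pi1 := (w.map M.genX).prod

theorem wordElt_cons (M : Mealy S X) (x : X) (w : List X) :
    M.wordElt (x :: w) = M.genX x * M.wordElt w := by
  simp [wordElt]

section freeAction

variable [Finite S] (M : Mealy S X) (hb : M.Bireversible)

/-- The permutation of the free group on the alphabet defined by a state. -/
noncomputable def freePerm (s : S) : Equiv.Perm (FreeGroup X) where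
  toFun w := ((M.run hb.2.1 w).unop (1, s)).1
  invFun w := (((M.inverse hb).run (M.inverse_t_bijective hb) w).unop (1, s)).1
  left_inv w := congrArg Prod.fst <|
    (M.isInverse_inverse hb).run_run hb.2.1 (M.inverse_t_bijective hb) w s
  right_inv w := congrArg Prod.fst <|
    ((M.isInverse_inverse hb).symm fun s => (hb.1 s).2).run_run (M.inverse_t_bijective hb) hb.2.1 w s

theorem freePerm_one (s : S) : M.freePerm hb s 1 = 1 := by
  simp [freePerm]

theorem freePerm_of_mul (s : S) (x : X) (w : FreeGroup X) :
    M.freePerm hb s (FreeGroup.of x * w) =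
      FreeGroup.of (M.o s x) * M.freePerm hb (M.t s x) w := by
  simp only [freePerm, Equiv.coe_fn_mk]
  rw [run_mul_apply, run_of_apply, run_apply, one_mul]

/-- The action of `π₁(Δ_A)` on the free group on the alphabet, where letters act by left
multiplication and states act as transducers. -/
noncomputable def freeAction : M.Pi1 →* Equiv.Perm (FreeGroup X) :=
  PresentedGroup.toGroup
    (f := Sum.elim (M.freePerm hb) fun x => Equiv.mulLeft (FreeGroup.of x)) <| by
    intro r hr
    simp only [rels, Set.mem_iUnion, Set.mem_singleton_iff] at hr
    obtain ⟨s, x, rfl⟩ := hr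
    simp only [map_mul, map_inv, FreeGroup.lift_apply_of, Sum.elim_inl, Sum.elim_inr]
    rw [mul_inv_eq_one, mul_inv_eq_iff_eq_mul]
    ext1 w
    exact M.freePerm_of_mul hb s x w

theorem freeAction_genS (s : S) : M.freeAction hb (M.genS s) = M.freePerm hb s :=
  PresentedGroup.toGroup.of _

theorem freeAction_genX (x : X) :
    M.freeAction hb (M.genX x) = Equiv.mulLeft (FreeGroup.of x) :=
  PresentedGroup.toGroup.of _

theorem freeAction_apply_one_of_mem_subS {a : M.Pi1} (ha : a ∈ M.subS) :
    M.freeAction hb a 1 = 1 := by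
  have : M.subS ≤ (MulAction.stabilizer (Equiv.Perm (FreeGroup X)) (1 : FreeGroup X)).comap
      (M.freeAction hb) := by
    rw [subS, Subgroup.closure_le]
    rintro _ ⟨s, rfl⟩
    rw [SetLike.mem_coe, Subgroup.mem_comap, MulAction.mem_stabilizer_iff, freeAction_genS]
    exact M.freePerm_one hb s
  exact this ha

theorem freeAction_lift_genX (w u : FreeGroup X) :
    M.freeAction hb (FreeGroup.lift M.genX w) u = w * u := by
  induction w using FreeGroup.induction_on generalizing u with
  | C1 => simp
  | of x => simp [freeAction_genX]
  | inv_of x _ => simp [freeAction_genX]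
  | mul v w hv hw => simp [hv, hw, mul_assoc]

theorem subS_inf_subX (hb : M.Bireversible) : M.subS ⊓ M.subX = ⊥ := by
  rw [eq_bot_iff]
  rintro p ⟨hpS, hpX⟩
  rw [SetLike.mem_coe, subX, ← FreeGroup.range_lift_eq_closure] at hpX
  obtain ⟨w, rfl⟩ := hpX
  have := M.freeAction_apply_one_of_mem_subS hb hpS
  rw [freeAction_lift_genX, mul_one] at this
  simp [this]

theorem wordElt_mul_injective (hb : M.Bireversible) {v w : List X} {a : M.Pi1}
    (ha : a ∈ M.subS) (h : M.wordElt v = M.wordElt w * a) : v = w := by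
  classical
  have hw : ∀ w : List X, M.wordElt w = FreeGroup.lift M.genX (FreeGroup.mk (w.map (·, true))) :=
    fun w => by simp [wordElt, FreeGroup.lift_mk, Function.comp_def]
  have key := congrArg (fun p => M.freeAction hb p 1) h
  simp only [map_mul, Equiv.Perm.mul_apply, M.freeAction_apply_one_of_mem_subS hb ha, hw,
    freeAction_lift_genX, mul_one] at key
  have hred : ∀ w : List X, FreeGroup.reduce (w.map (·, true)) = w.map (·, true) := fun w => by
    refine FreeGroup.IsReduced.reduce_eq ?_
    rw [FreeGroup.IsReduced, List.isChain_map]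
    induction w with
    | nil => simp
    | cons x w ih => cases w <;> simp_all
  have := congrArg FreeGroup.toWord key
  rw [FreeGroup.toWord_mk, FreeGroup.toWord_mk, hred, hred] at this
  exact List.map_injective_iff.2 (fun _ _ h => congrArg Prod.fst h) this

end freeAction

end Mealy

namespace Mealy

variable {S X : Type} (M : Mealy S X)

theorem isRep_gen : M.IsRep M.genS M.genX := fun s x => by
  have h := PresentedGroup.one_of_mem (rels := M.rels)
    (Set.mem_iUnion₂.2 ⟨s, x, Set.mem_singleton _⟩)
  simp only [map_mul, map_inv] at h
  rwa [mul_inv_eq_one, mul_inv_eq_iff_eq_mul] at h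

theorem subS_sup_subX : M.subS ⊔ M.subX = ⊤ := by
  rw [subS, subX, ← Subgroup.closure_union, eq_top_iff, ← PresentedGroup.closure_range_of]
  refine Subgroup.closure_mono ?_
  rintro _ ⟨s | x, rfl⟩
  · exact Or.inl ⟨s, rfl⟩
  · exact Or.inr ⟨x, rfl⟩

theorem closure_range_inv {ι P : Type*} [Group P] (f : ι → P) :
    Subgroup.closure (Set.range f⁻¹) = Subgroup.closure (Set.range f) := by
  rw [← Subgroup.closure_inv, Set.inv_range]
  simp

variable {M}

theorem commensurator_subS [Finite X] (hb : M.Bireversible) :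
    Subgroup.Commensurable.commensurator M.subS = ⊤ :=
  M.isRep_gen.commensurator_eq_top hb M.subS_sup_subX

theorem commensurator_subX [Finite S] (hb : M.Bireversible) :
    Subgroup.Commensurable.commensurator M.subX = ⊤ := by
  have := M.isRep_gen.dual.commensurator_eq_top hb.dual
  rw [closure_range_inv, closure_range_inv] at this
  exact this (sup_comm M.subX M.subS ▸ M.subS_sup_subX)

theorem exists_subX_mul_subS (hb : M.Bireversible) (p : M.Pi1) :
    ∃ b ∈ M.subX, ∃ a ∈ M.subS, p = b * a :=
  M.isRep_gen.exists_eq_mul hb M.subS_sup_subX p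

theorem exists_subS_mul_subX (hb : M.Bireversible) (p : M.Pi1) :
    ∃ a ∈ M.subS, ∃ b ∈ M.subX, p = a * b := by
  obtain ⟨b, hbX, a, ha, e⟩ := exists_subX_mul_subS hb p⁻¹
  exact ⟨a⁻¹, inv_mem ha, b⁻¹, inv_mem hbX, by rw [← mul_inv_rev, ← e, inv_inv]⟩

theorem reducible_iff_normalCore [Finite S] [Finite X] (hb : M.Bireversible) :
    M.Reducible ↔ M.subS.normalCore.relIndex M.subS ≠ 0 := by
  constructor
  · rintro ⟨K, H, hK, hH, hc, -, hf⟩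
    exact Subgroup.normalCore_relIndex_ne_zero (M.subS_inf_subX hb) (exists_subX_mul_subS hb)
      (commensurator_subS hb) hK hH hc hf
  · exact Subgroup.exists_commuting_of_normalCore_relIndex_ne_zero (M.subS_inf_subX hb)
      (exists_subS_mul_subX hb) (Group.closure_finite_fg _) (commensurator_subX hb)

/-- The element `a` of `⟨S⟩` acts on words over the alphabet as the permutation `σ`. -/
def ActsAs (M : Mealy S X) (a : M.Pi1) (σ : Equiv.Perm (List X)) : Prop :=
  ∀ w, ∃ b ∈ M.subS, a * M.wordElt w = M.wordElt (σ w) * b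

theorem ActsAs.one : M.ActsAs 1 1 := fun w => ⟨1, one_mem _, by simp⟩

theorem ActsAs.mul {a a' : M.Pi1} {σ σ' : Equiv.Perm (List X)} (h : M.ActsAs a σ)
    (h' : M.ActsAs a' σ') : M.ActsAs (a * a') (σ * σ') := fun w => by
  obtain ⟨b', hb', e'⟩ := h' w
  obtain ⟨b, hb, e⟩ := h (σ' w)
  exact ⟨b * b', mul_mem hb hb', by
    rw [mul_assoc, e', ← mul_assoc, e, mul_assoc, Equiv.Perm.mul_apply]⟩

theorem ActsAs.inv {a : M.Pi1} {σ : Equiv.Perm (List X)} (h : M.ActsAs a σ) :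
    M.ActsAs a⁻¹ σ⁻¹ := fun w => by
  obtain ⟨b, hb, e⟩ := h (σ⁻¹ w)
  refine ⟨b⁻¹, inv_mem hb, ?_⟩
  rw [inv_mul_eq_iff_eq_mul, ← mul_assoc, e, mul_inv_cancel_right,
    show σ (σ⁻¹ w) = w from σ.apply_symm_apply w]

theorem ActsAs.unique [Finite S] (hb : M.Bireversible) {a : M.Pi1} {σ τ : Equiv.Perm (List X)}
    (h : M.ActsAs a σ) (h' : M.ActsAs a τ) : σ = τ := by
  ext1 w
  obtain ⟨b, hbS, e⟩ := h w
  obtain ⟨b', hbS', e'⟩ := h' w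
  refine M.wordElt_mul_injective hb (mul_mem hbS' (inv_mem hbS)) ?_
  rw [← mul_assoc, ← e', e, mul_inv_cancel_right]

/-- If `a x = y b` then the permutation of `a` is read off from that of `b` on words that start
with `x`. -/
theorem ActsAs.apply_cons [Finite S] (hb : M.Bireversible) {a b : M.Pi1}
    {σ τ : Equiv.Perm (List X)} (h : M.ActsAs a σ) (h' : M.ActsAs b τ) {x y : X}
    (e : a * M.genX x = M.genX y * b) (w : List X) : σ (x :: w) = y :: τ w := by
  obtain ⟨c, hc, e₁⟩ := h (x :: w)
  obtain ⟨d, hd, e₂⟩ := h' w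
  refine M.wordElt_mul_injective hb (mul_mem hd (inv_mem hc)) ?_
  rw [← mul_assoc, eq_mul_inv_iff_mul_eq, ← e₁, wordElt_cons, wordElt_cons, ← mul_assoc, e,
    mul_assoc, e₂, mul_assoc]

theorem actsAs_genS {s : S} {σ : Equiv.Perm (List X)} (hσ : ⇑σ = M.actWord s) :
    M.ActsAs (M.genS s) σ := fun w => by
  rw [hσ]
  clear hσ
  induction w generalizing s with
  | nil => exact ⟨_, Subgroup.subset_closure ⟨s, rfl⟩, by simp [wordElt, actWord]⟩
  | cons x w ih =>
    obtain ⟨b, hb, e⟩ := @ih (M.t s x)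
    refine ⟨b, hb, ?_⟩
    rw [actWord, wordElt_cons, wordElt_cons, ← mul_assoc, isRep_gen, mul_assoc, e, mul_assoc]

theorem exists_perm_actWord (hb : M.Bireversible) (s : S) :
    ∃ σ : Equiv.Perm (List X), ⇑σ = M.actWord s :=
  ⟨⟨M.actWord s, (M.inverse hb).actWord s, (M.isInverse_inverse hb).actWord_leftInverse s,
    ((M.isInverse_inverse hb).symm fun s => (hb.1 s).2).actWord_leftInverse s⟩, rfl⟩

theorem exists_actsAs_of_mem_subS (hb : M.Bireversible) {a : M.Pi1} (ha : a ∈ M.subS) :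
    ∃ σ ∈ M.autGroup, M.ActsAs a σ := by
  induction ha using Subgroup.closure_induction with
  | mem _ hs =>
    obtain ⟨s, rfl⟩ := hs
    obtain ⟨σ, hσ⟩ := exists_perm_actWord hb s
    exact ⟨σ, Subgroup.subset_closure ⟨s, hσ⟩, actsAs_genS hσ⟩
  | one => exact ⟨1, one_mem _, .one⟩
  | mul _ _ _ _ ih ih' =>
    obtain ⟨σ, hσ, h⟩ := ih
    obtain ⟨τ, hτ, h'⟩ := ih'
    exact ⟨σ * τ, mul_mem hσ hτ, h.mul h'⟩
  | inv _ _ ih =>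
    obtain ⟨σ, hσ, h⟩ := ih
    exact ⟨σ⁻¹, inv_mem hσ, h.inv⟩

theorem exists_actsAs_of_mem_autGroup {σ : Equiv.Perm (List X)} (hσ : σ ∈ M.autGroup) :
    ∃ a ∈ M.subS, M.ActsAs a σ := by
  induction hσ using Subgroup.closure_induction with
  | mem _ hs =>
    obtain ⟨s, hs⟩ := hs
    exact ⟨_, Subgroup.subset_closure ⟨s, rfl⟩, actsAs_genS hs⟩
  | one => exact ⟨1, one_mem _, .one⟩
  | mul _ _ _ _ ih ih' =>
    obtain ⟨a, ha, h⟩ := ih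
    obtain ⟨b, hb, h'⟩ := ih'
    exact ⟨a * b, mul_mem ha hb, h.mul h'⟩
  | inv _ _ ih =>
    obtain ⟨a, ha, h⟩ := ih
    exact ⟨a⁻¹, inv_mem ha, h.inv⟩

/-- If the automaton group is finite, an element `a` acting trivially on words and satisfying
`g x = y a` forces `g` to act trivially and `y = x`. -/
theorem ActsAs.eq_one_of_finite [Finite S] (hb : M.Bireversible) [Finite M.autGroup]
    {g a : M.Pi1} (ha : M.ActsAs a 1) (hg : g ∈ M.subS) {x y : X}
    (e : g * M.genX x = M.genX y * a) : M.ActsAs g 1 ∧ y = x := by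
  have hD : ∀ σ : M.autGroup, ∃ τ : M.autGroup, ∃ y, ∀ w, σ.1 (x :: w) = y :: τ.1 w := by
    rintro ⟨σ, hσ⟩
    obtain ⟨c, hc, hcσ⟩ := exists_actsAs_of_mem_autGroup hσ
    obtain ⟨d, hd, y, e⟩ := M.isRep_gen.exists_mul_letter hb hc x
    obtain ⟨τ, hτ, hdτ⟩ := exists_actsAs_of_mem_subS hb hd
    exact ⟨⟨τ, hτ⟩, y, hcσ.apply_cons hb hdτ e⟩
  choose D y' hD using hD
  have hD_eq : ∀ (σ τ : M.autGroup) (y : X), (∀ w, σ.1 (x :: w) = y :: τ.1 w) → D σ = τ := by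
    intro σ τ y h
    ext1
    ext1 w
    exact (List.cons.inj ((hD σ w).symm.trans (h w))).2
  have hsurj : Function.Surjective D := by
    rintro ⟨τ, hτ⟩
    obtain ⟨d, hd, hdτ⟩ := exists_actsAs_of_mem_autGroup hτ
    obtain ⟨c, hc, y, e⟩ := M.isRep_gen.exists_letter_mul hb hd x
    obtain ⟨σ, hσ, hcσ⟩ := exists_actsAs_of_mem_subS hb hc
    exact ⟨⟨σ, hσ⟩, hD_eq _ _ y (hcσ.apply_cons hb hdτ e)⟩
  obtain ⟨σ, hσ, hgσ⟩ := exists_actsAs_of_mem_subS hb hg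
  have h := hgσ.apply_cons hb ha e
  have h₁ : D ⟨σ, hσ⟩ = 1 := hD_eq _ 1 y h
  have h₂ : D 1 = 1 := hD_eq 1 1 x fun _ => rfl
  obtain rfl : σ = 1 := congrArg Subtype.val
    (Finite.injective_iff_surjective.2 hsurj (h₁.trans h₂.symm))
  exact ⟨hgσ, (List.cons.inj (h [])).1.symm⟩

/-- The elements of `⟨S⟩` that act trivially on words over the alphabet. -/
def actionKernel (M : Mealy S X) : Subgroup M.Pi1 where
  carrier := {a | a ∈ M.subS ∧ M.ActsAs a 1}
  one_mem' := ⟨one_mem _, .one⟩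
  mul_mem' h h' := ⟨mul_mem h.1 h'.1, by simpa using h.2.mul h'.2⟩
  inv_mem' h := ⟨inv_mem h.1, by simpa using h.2.inv⟩

theorem actionKernel_normal [Finite S] (hb : M.Bireversible) [Finite M.autGroup] :
    M.actionKernel.Normal := by
  rw [← Subgroup.normalizer_eq_top_iff, eq_top_iff, ← M.subS_sup_subX]
  refine sup_le (fun a ha => ?_) ((Subgroup.closure_le _).2 ?_)
  · have key : ∀ a ∈ M.subS, ∀ n ∈ M.actionKernel, a * n * a⁻¹ ∈ M.actionKernel := by
      intro a ha n hn
      obtain ⟨σ, -, hσ⟩ := exists_actsAs_of_mem_subS hb ha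
      exact ⟨mul_mem (mul_mem ha hn.1) (inv_mem ha), by simpa using (hσ.mul hn.2).mul hσ.inv⟩
    refine Subgroup.mem_normalizer_iff.2 fun n => ⟨key a ha n, fun h => ?_⟩
    simpa [mul_assoc] using key _ (inv_mem ha) _ h
  · rintro _ ⟨x, rfl⟩
    refine Subgroup.mem_normalizer_iff.2 fun n => ⟨fun hn => ?_, fun hn => ?_⟩
    · obtain ⟨g, hg, y, e⟩ := M.isRep_gen.exists_letter_mul hb hn.1 x
      obtain ⟨h₁, rfl⟩ := hn.2.eq_one_of_finite hb hg e
      rw [← e, mul_inv_cancel_right]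
      exact ⟨hg, h₁⟩
    · obtain ⟨b, hbS, e⟩ := hn.2 [x]
      have hnb : n = b := by simpa [wordElt] using e
      refine ⟨hnb ▸ hbS, fun w => ?_⟩
      obtain ⟨c, hc, e'⟩ := hn.2 (x :: w)
      refine ⟨c, hc, ?_⟩
      simpa [wordElt_cons, mul_assoc] using e'

theorem finite_autGroup_iff_normalCore [Finite S] (hb : M.Bireversible) :
    Finite M.autGroup ↔ M.subS.normalCore.relIndex M.subS ≠ 0 := by
  choose f hfmem hf using fun a : M.subS => exists_actsAs_of_mem_subS hb a.2
  constructor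
  · intro hfin
    have hrel : M.actionKernel.relIndex M.subS ≠ 0 := by
      refine Subgroup.relIndex_ne_zero_of_finite_separation
        (fun a => (⟨f a, hfmem a⟩ : M.autGroup)) fun a b e => ?_
      have e : f a = f b := congrArg Subtype.val e
      refine ⟨mul_mem (inv_mem a.2) b.2, ?_⟩
      have := (hf a).inv.mul (hf b)
      rwa [e, inv_mul_cancel] at this
    have := actionKernel_normal hb
    exact fun h => hrel (Subgroup.relIndex_eq_zero_of_le_left
      (Subgroup.normal_le_normalCore.2 fun a ha => ha.1) h)
  · intro hrel
    have : Finite (M.subS ⧸ M.subS.normalCore.subgroupOf M.subS) :=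
      Nat.finite_of_card_ne_zero hrel
    refine Finite.of_surjective (fun q : M.subS ⧸ M.subS.normalCore.subgroupOf M.subS =>
      (⟨f q.out, hfmem _⟩ : M.autGroup)) ?_
    rintro ⟨σ, hσ⟩
    obtain ⟨a, ha, haσ⟩ := exists_actsAs_of_mem_autGroup hσ
    refine ⟨QuotientGroup.mk ⟨a, ha⟩, Subtype.ext ?_⟩
    obtain ⟨c, hc⟩ := QuotientGroup.mk_out_eq_mul (M.subS.normalCore.subgroupOf M.subS) ⟨a, ha⟩
    have hcC : ((c : M.subS) : M.Pi1) ∈ M.subS.normalCore := Subgroup.mem_subgroupOf.1 c.2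
    have hc1 : M.ActsAs ((c : M.subS) : M.Pi1) 1 := fun w =>
      ⟨_, by simpa using hcC (M.wordElt w)⁻¹, by simp [mul_assoc]⟩
    have h := hf (QuotientGroup.mk ⟨a, ha⟩ : M.subS ⧸ M.subS.normalCore.subgroupOf M.subS).out
    refine h.unique hb ?_
    rw [hc]
    simpa using haσ.mul hc1

theorem finite_autGroup_iff_reducible [Finite S] [Finite X] (hb : M.Bireversible) :
    Finite M.autGroup ↔ M.Reducible :=
  (finite_autGroup_iff_normalCore hb).trans (reducible_iff_normalCore hb).symm

/-- Inverting generators identifies the square-complex group of the dual automaton with that of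
`M`. -/
def dualHom (M : Mealy S X) : M.dual.Pi1 →* M.Pi1 :=
  PresentedGroup.toGroup (f := Sum.elim M.genX⁻¹ M.genS⁻¹) <| by
    intro r hr
    simp only [rels, Set.mem_iUnion, Set.mem_singleton_iff] at hr
    obtain ⟨x, s, rfl⟩ := hr
    simp only [map_mul, map_inv, FreeGroup.lift_apply_of, Sum.elim_inl, Sum.elim_inr]
    rw [mul_inv_eq_one, mul_inv_eq_iff_eq_mul]
    exact M.isRep_gen.dual x s

theorem dualHom_genS (x : X) : M.dualHom (M.dual.genS x) = (M.genX x)⁻¹ :=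
  PresentedGroup.toGroup.of _

theorem dualHom_genX (s : S) : M.dualHom (M.dual.genX s) = (M.genS s)⁻¹ :=
  PresentedGroup.toGroup.of _

theorem dualHom_dualHom (p : M.Pi1) : M.dualHom (M.dual.dualHom p) = p := by
  have : M.dualHom.comp M.dual.dualHom = MonoidHom.id _ := by
    refine PresentedGroup.ext ?_
    rintro (s | x)
    · change M.dualHom (M.dual.dualHom (M.dual.dual.genS s)) = M.genS s
      rw [dualHom_genS, map_inv, dualHom_genX, inv_inv]
    · change M.dualHom (M.dual.dualHom (M.dual.dual.genX x)) = M.genX x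
      rw [dualHom_genX, map_inv, dualHom_genS, inv_inv]
  exact DFunLike.congr_fun this p

/-- The square-complex groups of an automaton and its dual are isomorphic. -/
def dualEquiv (M : Mealy S X) : M.dual.Pi1 ≃* M.Pi1 where
  __ := M.dualHom
  invFun := M.dual.dualHom
  left_inv := M.dual.dualHom_dualHom
  right_inv := M.dualHom_dualHom

theorem map_dualEquiv_subS : M.dual.subS.map M.dualEquiv.toMonoidHom = M.subX := by
  rw [subS, subX, MonoidHom.map_closure, ← Set.range_comp, ← closure_range_inv M.genX]
  exact congrArg (fun f => Subgroup.closure (Set.range f)) (funext fun x => M.dualHom_genS x)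

theorem map_dualEquiv_subX : M.dual.subX.map M.dualEquiv.toMonoidHom = M.subS := by
  rw [subS, subX, MonoidHom.map_closure, ← Set.range_comp, ← closure_range_inv M.genS]
  exact congrArg (fun f => Subgroup.closure (Set.range f)) (funext fun s => M.dualHom_genX s)

theorem Reducible.of_dual (h : M.dual.Reducible) : M.Reducible := by
  obtain ⟨K, H, hK, hH, hc, hKH, hf⟩ := h
  refine ⟨H.map M.dualEquiv.toMonoidHom, K.map M.dualEquiv.toMonoidHom,
    map_dualEquiv_subX (M := M) ▸ Subgroup.map_mono hH,
    map_dualEquiv_subS (M := M) ▸ Subgroup.map_mono hK, ?_, ?_, ?_⟩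
  · rintro _ ⟨h, hh, rfl⟩ _ ⟨k, hk, rfl⟩
    exact (hc k hk h hh).symm.map M.dualEquiv.toMonoidHom
  · rw [← Subgroup.map_inf H K M.dualEquiv.toMonoidHom M.dualEquiv.injective, inf_comm, hKH,
      Subgroup.map_bot]
  · rw [← Subgroup.map_sup, sup_comm]
    exact ⟨(Subgroup.index_map_equiv (K ⊔ H) M.dualEquiv).trans_ne hf.index_ne_zero⟩

theorem reducible_dual_iff : M.dual.Reducible ↔ M.Reducible :=
  ⟨Reducible.of_dual, fun h => Reducible.of_dual (M := M.dual) h⟩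

end Mealy

/-- For a bireversible automaton: `G_A` is finite iff `G_{∂A}` is finite iff
`π₁(Δ_A)` is reducible. -/
theorem finite_iff_dual_finite_iff_reducible {S X : Type} [Finite S] [Finite X]
    [Nonempty S] [Nonempty X] (M : Mealy S X) (hb : M.Bireversible) :
    (Finite M.autGroup ↔ Finite M.dualAutGroup) ∧
    (Finite M.autGroup ↔ M.Reducible) := by
  have h := finite_autGroup_iff_reducible hb
  refine ⟨?_, h⟩
  rw [h, ← M.autGroup_dual, finite_autGroup_iff_reducible hb.dual, reducible_dual_iff]
end
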